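/- Let m, j ≥ 1 and H_j = h_j(x_1^m,...,x_n^m). Then ∑_{i=1}^n (x_1 ⋯ x̂_i ⋯ x_n)^{m-1} · ∂_{x_i} H_j = (x_1 ⋯ x_n)^{m-1} · m(n+j-1) · H_{j-1}, where (x_1 ⋯ x̂_i ⋯ x_n) denotes the product of all variables except x_i. -/

import Mathlib

open MvPolynomial

/-- `H j = h_j(x_1^m, …, x_n^m)`, the complete homogeneous symmetric polynomial of degree `j`
evaluated at the `m`-th powers of the variables. -/
noncomputable def Hpow (K : Type*) [Field K] (n m j : ℕ) : MvPolynomial (Fin n) K :=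
  aeval (fun k : Fin n => (X k : MvPolynomial (Fin n) K) ^ m) (hsymm (Fin n) K j)

/-- The coefficients of `hsymm`. -/
theorem aux_coeff_hsymm (K : Type*) [Field K] (n j : ℕ) (d : Fin n →₀ ℕ) :
    coeff d (hsymm (Fin n) K j) = if d.degree = j then 1 else 0 := by
  classical
  have h1 : ∀ s : Multiset (Fin n), (s.map (X : Fin n → MvPolynomial (Fin n) K)).prod
      = monomial (Multiset.toFinsupp s) 1 := by
    intro s
    induction s using Multiset.induction_on with
    | empty => simp
    | cons a s ih =>
      rw [Multiset.map_cons, Multiset.prod_cons, ih, ← Multiset.singleton_add, map_add,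
        Multiset.toFinsupp_singleton, X, monomial_mul, one_mul]
  have hcard : Multiset.card (Finsupp.toMultiset d) = d.degree := by
    rw [Finsupp.card_toMultiset]; rfl
  simp only [hsymm, coeff_sum, h1, coeff_monomial]
  split_ifs with h
  · refine (Finset.sum_eq_single
      (⟨Finsupp.toMultiset d, hcard.trans h⟩ : Sym (Fin n) j) ?_ ?_).trans ?_
    · intro b _ hb
      rw [if_neg]
      intro hbd
      apply hb
      apply Subtype.ext
      simp [← hbd]
    · intro hne
      exact absurd (Finset.mem_univ (α := Sym (Fin n) j) _) hne
    · simp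
  · apply Finset.sum_eq_zero
    intro s _
    rw [if_neg]
    intro hs
    apply h
    rw [← hcard, ← hs]
    simpa using s.2

theorem aux_sum_pderiv (K : Type*) [Field K] (n j : ℕ) :
    ∑ i : Fin n, pderiv i (hsymm (Fin n) K (j + 1)) =
      ((n + j : ℕ) : MvPolynomial (Fin n) K) * hsymm (Fin n) K j := by
  ext d
  rw [coeff_sum, ← map_natCast (C : K →+* MvPolynomial (Fin n) K), coeff_C_mul]
  simp only [coeff_pderiv, aux_coeff_hsymm, map_add, Finsupp.degree_single, add_left_inj]
  split_ifs with h
  · subst h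
    simp [Finset.sum_add_distrib, Finsupp.degree_eq_sum, add_comm]
  · simp

theorem aux_chain (K : Type*) [Field K] (n m : ℕ) (i : Fin n) (p : MvPolynomial (Fin n) K) :
    pderiv i (aeval (fun k : Fin n => (X k : MvPolynomial (Fin n) K) ^ m) p) =
      (m : MvPolynomial (Fin n) K) * X i ^ (m - 1) *
        aeval (fun k : Fin n => (X k : MvPolynomial (Fin n) K) ^ m) (pderiv i p) := by
  induction p using MvPolynomial.induction_on with
  | C a => simp [algebraMap_eq]
  | add p q hp hq => simp only [map_add, hp, hq, mul_add]
  | mul_X p k hp =>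
    simp only [map_mul, Derivation.leibniz, hp, aeval_X, smul_eq_mul, map_add, pderiv_pow]
    by_cases hk : k = i
    · subst hk
      simp only [pderiv_X_self, map_one]
      ring
    · simp only [pderiv_X_of_ne hk, map_zero]
      ring

/-- `∑_{i=1}^n (x_1 ⋯ x̂_i ⋯ x_n)^{m-1} ∂_{x_i} H_j = (x_1 ⋯ x_n)^{m-1} m(n+j-1) H_{j-1}`. -/
theorem sum_pderiv_Hpow (K : Type*) [Field K] [CharZero K]
    (n m j : ℕ) (hm : 1 ≤ m) (hj : 1 ≤ j) :
    ∑ i : Fin n, (∏ k ∈ Finset.univ.erase i, (X k : MvPolynomial (Fin n) K)) ^ (m - 1)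
        * pderiv i (Hpow K n m j) =
      (∏ k : Fin n, (X k : MvPolynomial (Fin n) K)) ^ (m - 1)
        * ((m * (n + j - 1) : ℕ) : MvPolynomial (Fin n) K) * Hpow K n m (j - 1) := by
  obtain ⟨j, rfl⟩ : ∃ k, j = k + 1 := ⟨j - 1, by omega⟩
  have h := congrArg (aeval (fun k : Fin n => (X k : MvPolynomial (Fin n) K) ^ m))
    (aux_sum_pderiv K n j)
  rw [map_sum, map_mul, map_natCast] at h
  have e : n + (j + 1) - 1 = n + j := by omega
  simp only [Hpow, aux_chain, e, Nat.add_sub_cancel]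
  rw [Nat.cast_mul, mul_assoc, mul_assoc, ← h, Finset.mul_sum, Finset.mul_sum]
  refine Finset.sum_congr rfl fun i _ => ?_
  rw [← Finset.mul_prod_erase Finset.univ _ (Finset.mem_univ i), mul_pow]
  ring
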